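/- Let χ = 1 be the trivial character of T. Then V_1^{K_1} has complex dimension q+1, the constant functions form a one-dimensional K-invariant subspace of V_1^{K_1}, this subspace has a unique K-invariant complement in V_1^{K_1}, and that complement is an irreducible K-representation of dimension q. -/

import Mathlib

open Matrix

noncomputable section

/-- A 2×2 matrix over `E`. -/
abbrev Mat (E : Type) := Matrix (Fin 2) (Fin 2) E

/-- The context: `E/F` is the unramified quadratic extension of a finite extension `F` of
`ℚ_p` (`p` odd), encoded via the Galois involution `sig` (whose fixed field is `F`),
the valuation `nu` (normalized by `nu ϖ = 1` for a uniformizer `ϖ` of `F`),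
a square root `sqeps` of a non-square unit `eps = sqeps^2` of `O_F`, the residue-field
cardinality `q` of `F`, and an additive character `psi'` of `F` trivial on `p_F` and
nontrivial on `O_F`. -/
structure USetting (E : Type) [Field E] where
  sig : E →+* E
  nu : E → WithTop ℤ
  sqeps : E
  pi : E
  q : ℕ
  psi' : E → ℂ
  sig_invol : ∀ x, sig (sig x) = x
  sig_ne : ∃ x, sig x ≠ x
  nu_eq_top : ∀ x, nu x = ⊤ ↔ x = 0
  nu_mul : ∀ x y, nu (x * y) = nu x + nu y
  nu_add : ∀ x y, min (nu x) (nu y) ≤ nu (x + y)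
  nu_sig : ∀ x, nu (sig x) = nu x
  nu_pi : nu pi = 1
  sig_pi : sig pi = pi
  sig_sqeps : sig sqeps = - sqeps
  nu_sqeps : nu sqeps = 0
  eps_not_square : ∀ y, sig y = y → y * y ≠ sqeps * sqeps
  gen : ∀ x : E, ∃ a b, sig a = a ∧ sig b = b ∧ x = a + b * sqeps
  nu_two : nu 2 = 0
  charzero : ∀ n : ℕ, (n : E) = 0 → n = 0
  complete : ∀ f : ℕ → E, (∀ n : ℕ, ((n : ℤ) : WithTop ℤ) ≤ nu (f (n + 1) - f n)) →
    ∃ L, ∀ n : ℕ, ((n : ℤ) : WithTop ℤ) ≤ nu (L - f n)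
  res_card : ∃ R : Finset E, R.card = q ∧ (∀ x ∈ R, sig x = x ∧ 0 ≤ nu x) ∧
    ∀ y : E, sig y = y → 0 ≤ nu y → ∃! x, x ∈ R ∧ 1 ≤ nu (y - x)
  psi'_mul : ∀ x y, sig x = x → sig y = y → psi' (x + y) = psi' x * psi' y
  psi'_ne : ∀ x, sig x = x → psi' x ≠ 0
  psi'_triv : ∀ x, sig x = x → 1 ≤ nu x → psi' x = 1
  psi'_nontriv : ∃ x, sig x = x ∧ 0 ≤ nu x ∧ psi' x ≠ 1

variable {E : Type} [Field E]

/-- The matrix `w₀ = [[0,1],[1,0]]`. -/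
def w0 (E : Type) [Field E] : Mat E := !![0, 1; 1, 0]

/-- `G = U(1,1)(F)`. -/
def Gset (S : USetting E) : Set (Mat E) :=
  {g | (g.map ⇑S.sig)ᵀ * w0 E * g = w0 E}

/-- `K = G ∩ GL₂(O_E)`: entries in `O_E` and determinant in `O_E^×`. -/
def Kset (S : USetting E) : Set (Mat E) :=
  {g | g ∈ Gset S ∧ (∀ i j, 0 ≤ S.nu (g i j)) ∧ S.nu g.det = 0}

/-- The congruence filtration subgroup `K_n` (for `n ≥ 1`; `K_0 = K` as a set). -/
def Kfil (S : USetting E) (n : ℤ) : Set (Mat E) :=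
  {g | g ∈ Kset S ∧ ∀ i j, (n : WithTop ℤ) ≤ S.nu ((g - 1) i j)}

/-- `𝓑 = B ∩ K`, the upper triangular matrices in `K`. -/
def Bcal (S : USetting E) : Set (Mat E) := {g | g ∈ Kset S ∧ g 1 0 = 0}

/-- `E^1`, the norm-one elements of `E`. -/
def E1set (S : USetting E) : Set E := {x | x * S.sig x = 1}

/-- `O_F^×` as a subset of `E`. -/
def OFunits (S : USetting E) : Set E := {x | S.sig x = x ∧ S.nu x = 0}

/-- `O_E^×` as a subset of `E`. -/
def OEunits (S : USetting E) : Set E := {x | S.nu x = 0}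

/-- A character of `E^×`, encoded as a function `E → ℂ` multiplicative and
nonvanishing on nonzero elements. -/
def IsChar (χ : E → ℂ) : Prop :=
  (∀ x y : E, x ≠ 0 → y ≠ 0 → χ (x * y) = χ x * χ y) ∧ ∀ x : E, x ≠ 0 → χ x ≠ 0

/-- A group homomorphism `E^1 → ℂ^×`, encoded as a function `E → ℂ`. -/
def IsE1Hom (S : USetting E) (φ : E → ℂ) : Prop :=
  (∀ x ∈ E1set S, ∀ y ∈ E1set S, φ (x * y) = φ x * φ y) ∧ ∀ x ∈ E1set S, φ x ≠ 0

/-- A homomorphism into `ℂ^×` on a subset of matrices. -/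
def IsHomOn (A : Set (Mat E)) (Ψ : Mat E → ℂ) : Prop :=
  (∀ x ∈ A, ∀ y ∈ A, Ψ (x * y) = Ψ x * Ψ y) ∧ ∀ x ∈ A, Ψ x ≠ 0

/-- `1 + p_E^n`. -/
def onePE (S : USetting E) (n : ℤ) : Set E := {x | (n : WithTop ℤ) ≤ S.nu (x - 1)}

/-- `1 + p_F^n`. -/
def onePF (S : USetting E) (n : ℤ) : Set E :=
  {x | S.sig x = x ∧ (n : WithTop ℤ) ≤ S.nu (x - 1)}

/-- `χ` is trivial on a set. -/
def TrivOn (χ : E → ℂ) (s : Set E) : Prop := ∀ x ∈ s, χ x = 1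

/-- `χ` has depth `r`: trivial on `1+p_E^{r+1}` and (if `r ≥ 1`) nontrivial on `1+p_E^r`. -/
def HasDepth (S : USetting E) (χ : E → ℂ) (r : ℕ) : Prop :=
  TrivOn χ (onePE S ((r : ℤ) + 1)) ∧ (r = 0 ∨ ¬ TrivOn χ (onePE S (r : ℤ)))

/-- `χ` has true depth `r`: the depth of its restriction to `F^×` is `r`. -/
def HasTrueDepth (S : USetting E) (χ : E → ℂ) (r : ℕ) : Prop :=
  TrivOn χ (onePF S ((r : ℤ) + 1)) ∧ (r = 0 ∨ ¬ TrivOn χ (onePF S (r : ℤ)))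

/-- `χ` has minimal depth `r`: its depth and true depth both equal `r`. -/
def MinDepth (S : USetting E) (χ : E → ℂ) (r : ℕ) : Prop :=
  HasDepth S χ r ∧ HasTrueDepth S χ r

/-- Right translation action on functions. -/
def rho (g : Mat E) : (Mat E → ℂ) →ₗ[ℂ] (Mat E → ℂ) where
  toFun f := fun k => f (k * g)
  map_add' _ _ := rfl
  map_smul' _ _ := rfl

/-- The space `V_χ^{K_n}`: functions on `K` (extended by zero off `K`) satisfying
`f(bk) = χ(b₁₁) f(k)` for `b ∈ 𝓑` and right `K_n`-invariance. -/
def Vsp (S : USetting E) (χ : E → ℂ) (n : ℤ) : Submodule ℂ (Mat E → ℂ) where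
  carrier := {f | (∀ x, x ∉ Kset S → f x = 0) ∧
    (∀ b ∈ Bcal S, ∀ k ∈ Kset S, f (b * k) = χ (b 0 0) * f k) ∧
    (∀ k ∈ Kset S, ∀ g ∈ Kfil S n, f (k * g) = f k)}
  add_mem' := by
    rintro f g ⟨hf0, hf1, hf2⟩ ⟨hg0, hg1, hg2⟩
    refine ⟨fun x hx => ?_, fun b hb k hk => ?_, fun k hk g' hg' => ?_⟩
    · simp [hf0 x hx, hg0 x hx]
    · simp only [Pi.add_apply, hf1 b hb k hk, hg1 b hb k hk]; ring
    · simp only [Pi.add_apply, hf2 k hk g' hg', hg2 k hk g' hg']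
  zero_mem' := by
    refine ⟨fun x _ => rfl, fun b _ k _ => by simp, fun k _ g _ => rfl⟩
  smul_mem' := by
    rintro c f ⟨hf0, hf1, hf2⟩
    refine ⟨fun x hx => ?_, fun b hb k hk => ?_, fun k hk g' hg' => ?_⟩
    · simp [hf0 x hx]
    · simp only [Pi.smul_apply, hf1 b hb k hk, smul_eq_mul]; ring
    · simp only [Pi.smul_apply, hf2 k hk g' hg']

/-- The space of the representation induced from a character `Ψ` of a subgroup `H ⊆ K`:
functions on `K` (extended by zero) with `f(hk) = Ψ(h) f(k)`. -/
def IndSp (S : USetting E) (H : Set (Mat E)) (Ψ : Mat E → ℂ) : Submodule ℂ (Mat E → ℂ) where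
  carrier := {f | (∀ x, x ∉ Kset S → f x = 0) ∧
    ∀ h ∈ H, ∀ k ∈ Kset S, f (h * k) = Ψ h * f k}
  add_mem' := by
    rintro f g ⟨hf0, hf1⟩ ⟨hg0, hg1⟩
    refine ⟨fun x hx => ?_, fun h hh k hk => ?_⟩
    · simp [hf0 x hx, hg0 x hx]
    · simp only [Pi.add_apply, hf1 h hh k hk, hg1 h hh k hk]; ring
  zero_mem' := ⟨fun x _ => rfl, fun h _ k _ => by simp⟩
  smul_mem' := by
    rintro c f ⟨hf0, hf1⟩
    refine ⟨fun x hx => ?_, fun h hh k hk => ?_⟩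
    · simp [hf0 x hx]
    · simp only [Pi.smul_apply, hf1 h hh k hk, smul_eq_mul]; ring

/-- The functions constant on `K` and zero off `K`. -/
def ConstSub (S : USetting E) : Submodule ℂ (Mat E → ℂ) where
  carrier := {f | (∀ x, x ∉ Kset S → f x = 0) ∧ ∃ c : ℂ, ∀ k ∈ Kset S, f k = c}
  add_mem' := by
    rintro f g ⟨hf0, c, hc⟩ ⟨hg0, c', hc'⟩
    exact ⟨fun x hx => by simp [hf0 x hx, hg0 x hx],
      c + c', fun k hk => by simp [hc k hk, hc' k hk]⟩
  zero_mem' := ⟨fun x _ => rfl, 0, fun _ _ => rfl⟩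
  smul_mem' := by
    rintro a f ⟨hf0, c, hc⟩
    exact ⟨fun x hx => by simp [hf0 x hx], a * c, fun k hk => by simp [hc k hk]⟩

/-- A subspace is `K`-invariant. -/
def KInvariant (S : USetting E) (W : Submodule ℂ (Mat E → ℂ)) : Prop :=
  ∀ g ∈ Kset S, ∀ f ∈ W, rho g f ∈ W

/-- A subset `A ⊆ K` acts trivially on `W`. -/
def ActsTrivially (S : USetting E) (A : Set (Mat E)) (W : Submodule ℂ (Mat E → ℂ)) : Prop :=
  ∀ g ∈ A, ∀ f ∈ W, rho g f = f

/-- `W` is an irreducible representation of `K`. -/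
def IsIrredRep (S : USetting E) (W : Submodule ℂ (Mat E → ℂ)) : Prop :=
  W ≠ ⊥ ∧ KInvariant S W ∧
    ∀ U : Submodule ℂ (Mat E → ℂ), U ≤ W → KInvariant S U → U = ⊥ ∨ U = W

/-- `V` and `W` are isomorphic as representations of `K`. -/
def RepIso (S : USetting E) (V W : Submodule ℂ (Mat E → ℂ)) : Prop :=
  ∃ e : (Mat E → ℂ) →ₗ[ℂ] (Mat E → ℂ), Set.BijOn ⇑e ↑V ↑W ∧
    ∀ g ∈ Kset S, ∀ f ∈ V, e (rho g f) = rho g (e f)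

/-- The space of `ℂ`-linear endomorphisms of `V` commuting with the right-translation
action of `K`, realized inside the function space `↥V → ↥V`. -/
def Commutant (S : USetting E) (V : Submodule ℂ (Mat E → ℂ)) :
    Submodule ℂ (↥V → ↥V) where
  carrier := {T | (∀ x y : ↥V, T (x + y) = T x + T y) ∧
    (∀ (c : ℂ) (x : ↥V), T (c • x) = c • T x) ∧
    ∀ g ∈ Kset S, ∀ f : ↥V, ∀ h : rho g (f : Mat E → ℂ) ∈ V,
      ((T ⟨rho g (f : Mat E → ℂ), h⟩ : ↥V) : Mat E → ℂ) = rho g ((T f : ↥V) : Mat E → ℂ)}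
  add_mem' := by
    rintro T T' ⟨hT1, hT2, hT3⟩ ⟨hT1', hT2', hT3'⟩
    refine ⟨fun x y => ?_, fun c x => ?_, fun g hg f h => ?_⟩
    · simp only [Pi.add_apply, hT1 x y, hT1' x y]; abel
    · simp only [Pi.add_apply, hT2 c x, hT2' c x, smul_add]
    · simp only [Pi.add_apply, Submodule.coe_add, hT3 g hg f h, hT3' g hg f h, map_add]
  zero_mem' := by
    refine ⟨fun x y => by simp, fun c x => by simp, fun g hg f h => by simp⟩
  smul_mem' := by
    rintro c T ⟨hT1, hT2, hT3⟩
    refine ⟨fun x y => ?_, fun a x => ?_, fun g hg f h => ?_⟩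
    · simp only [Pi.smul_apply, hT1 x y, smul_add]
    · simp only [Pi.smul_apply, hT2 a x, smul_comm c a]
    · simp only [Pi.smul_apply, Submodule.coe_smul, hT3 g hg f h, _root_.map_smul]

/-- The additive character `ψ` of `E`, `ψ(x) = ψ'((x + σ(x))/2)`. -/
def psiE (S : USetting E) (x : E) : ℂ := S.psi' ((x + S.sig x) / 2)

/-- `Ψ_Y(g) = ψ(Tr(Y (g − 1)))`. -/
def PsiC (S : USetting E) (Y g : Mat E) : ℂ := psiE S ((Y * (g - 1)).trace)

/-- The Lie algebra `𝔤 = 𝔲(1,1)(F)`. -/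
def gfrak (S : USetting E) : Set (Mat E) :=
  {Y | (Y.map ⇑S.sig)ᵀ * w0 E + w0 E * Y = 0}

/-- The lattice `𝔨_s` of the Lie algebra, where `c = ⌈s⌉`. -/
def kfrakC (S : USetting E) (c : ℤ) : Set (Mat E) :=
  {Y | Y ∈ gfrak S ∧ (c : WithTop ℤ) ≤ S.nu (Y 0 0) ∧ (c : WithTop ℤ) ≤ S.nu (Y 1 1) ∧
    (∃ t, S.sig t = t ∧ (c : WithTop ℤ) ≤ S.nu t ∧ Y 0 1 = S.sqeps * t) ∧
    (∃ t, S.sig t = t ∧ (c : WithTop ℤ) ≤ S.nu t ∧ Y 1 0 = S.sqeps * t)}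

/-- The group `J_d`. -/
def Jgrp (S : USetting E) (d : ℕ) : Set (Mat E) :=
  {g | g ∈ Kset S ∧ ((((d + 1) / 2 : ℕ) : WithTop ℤ) ≤ S.nu (g 0 0 - 1)) ∧
    ((((d + 1) / 2 : ℕ) : WithTop ℤ) ≤ S.nu (g 0 1)) ∧
    ((((d + 1) / 2 : ℕ) : WithTop ℤ) ≤ S.nu (g 1 1 - 1)) ∧
    (((d / 2 + 1 : ℕ) : WithTop ℤ) ≤ S.nu (g 1 0))}

/-- The centralizer `T(X)` in `K` of `X = [[z√ε, u√ε],[v√ε, z√ε]]`. -/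
def TXset (S : USetting E) (u v : E) : Set (Mat E) :=
  {m | m ∈ Kset S ∧ m 1 1 = m 0 0 ∧ m 1 0 = m 0 1 * (u⁻¹ * v)}

/-- The center `Z` of `G`, identified with scalar matrices with entries in `E^1`. -/
def Zset (S : USetting E) : Set (Mat E) := {m | ∃ z ∈ E1set S, m = z • (1 : Mat E)}

/-- `𝒰 = U ∩ K`. -/
def Uset (S : USetting E) : Set (Mat E) :=
  {m | ∃ b, S.sig b = b ∧ 0 ≤ S.nu b ∧ m = !![1, b * S.sqeps; 0, 1]}

/-- The set of products `T(X)·J_d`. -/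
def TXJ (S : USetting E) (u v : E) (d : ℕ) : Set (Mat E) :=
  {x | ∃ t ∈ TXset S u v, ∃ j ∈ Jgrp S d, x = t * j}

/-- The set of products `Z·𝒰·J_d`. -/
def ZUJ (S : USetting E) (d : ℕ) : Set (Mat E) :=
  {x | ∃ z ∈ Zset S, ∃ m ∈ Uset S, ∃ j ∈ Jgrp S d, x = z * m * j}

/-- `X = [[z√ε, u√ε],[v√ε, z√ε]]`. -/
def Xzuv (S : USetting E) (z u v : E) : Mat E :=
  !![z * S.sqeps, u * S.sqeps; v * S.sqeps, z * S.sqeps]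

/-- The nilpotent element `X_δ = [[0, δ√ε],[0,0]]`. -/
def Xdelta (S : USetting E) (δ : E) : Mat E := !![0, δ * S.sqeps; 0, 0]

/-- `W` is a `K`-invariant complement of `V_χ^{K_d}` inside `V_χ^{K_{d+1}}`. -/
def Wcompl (S : USetting E) (χ : E → ℂ) (d : ℕ) (W : Submodule ℂ (Mat E → ℂ)) : Prop :=
  W ≤ Vsp S χ ((d : ℤ) + 1) ∧ KInvariant S W ∧
    Vsp S χ (d : ℤ) ⊓ W = ⊥ ∧ Vsp S χ (d : ℤ) ⊔ W = Vsp S χ ((d : ℤ) + 1)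

namespace USetting

/-! ### The valuation -/

lemma nu_zero (S : USetting E) : S.nu 0 = ⊤ := (S.nu_eq_top 0).2 rfl

lemma nu_eq_zero_of_mul_self (S : USetting E) {x : E} (hx : x ≠ 0)
    (h : S.nu x + S.nu x = S.nu x ∨ S.nu x + S.nu x = 0) : S.nu x = 0 := by
  have h0 : S.nu x ≠ ⊤ := fun h => hx ((S.nu_eq_top x).1 h)
  obtain ⟨n, hn⟩ := WithTop.ne_top_iff_exists.1 h0
  rw [← hn] at h ⊢
  norm_cast at h ⊢
  omega

lemma nu_one (S : USetting E) : S.nu 1 = 0 :=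
  S.nu_eq_zero_of_mul_self one_ne_zero (Or.inl (by rw [← S.nu_mul, one_mul]))

lemma nu_neg (S : USetting E) (x : E) : S.nu (-x) = S.nu x := by
  have h : S.nu (-1) = 0 := S.nu_eq_zero_of_mul_self (neg_ne_zero.2 one_ne_zero)
    (Or.inr (by rw [← S.nu_mul, neg_one_mul, neg_neg, S.nu_one]))
  rw [← neg_one_mul, S.nu_mul, h, zero_add]

lemma le_nu_add (S : USetting E) {n : WithTop ℤ} {x y : E} (hx : n ≤ S.nu x) (hy : n ≤ S.nu y) :
    n ≤ S.nu (x + y) := (le_min hx hy).trans (S.nu_add x y)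

lemma le_nu_sub (S : USetting E) {n : WithTop ℤ} {x y : E} (hx : n ≤ S.nu x) (hy : n ≤ S.nu y) :
    n ≤ S.nu (x - y) := by
  rw [sub_eq_add_neg]
  exact S.le_nu_add hx (by rwa [S.nu_neg])

lemma le_nu_mul_left (S : USetting E) {n : WithTop ℤ} {x y : E} (hx : 0 ≤ S.nu x)
    (hy : n ≤ S.nu y) : n ≤ S.nu (x * y) := by
  rw [S.nu_mul, ← zero_add n]
  exact add_le_add hx hy

lemma le_nu_mul_right (S : USetting E) {n : WithTop ℤ} {x y : E} (hx : n ≤ S.nu x)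
    (hy : 0 ≤ S.nu y) : n ≤ S.nu (x * y) := by
  rw [mul_comm]
  exact S.le_nu_mul_left hy hx

lemma nu_mul_of_unit (S : USetting E) {x : E} (hx : S.nu x = 0) (y : E) :
    S.nu (x * y) = S.nu y := by
  rw [S.nu_mul, hx, zero_add]

lemma ne_zero_of_unit (S : USetting E) {x : E} (hx : S.nu x = 0) : x ≠ 0 := by
  rintro rfl
  simp [S.nu_zero] at hx

lemma nu_div_of_unit (S : USetting E) {y : E} (hy : S.nu y = 0) (x : E) :
    S.nu (x / y) = S.nu x := by
  rw [← S.nu_mul_of_unit hy (x / y), mul_div_cancel₀ x (S.ne_zero_of_unit hy)]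

lemma one_le_nu_of_ne_zero (S : USetting E) {x : E} (hx : 0 ≤ S.nu x) (h : S.nu x ≠ 0) :
    1 ≤ S.nu x := by
  cases hn : S.nu x with
  | top => exact le_top
  | coe n =>
    rw [hn] at hx h
    norm_cast at hx h ⊢
    omega

lemma one_le_nu_zero (S : USetting E) : 1 ≤ S.nu 0 := by
  rw [S.nu_zero]
  exact le_top

lemma not_one_le_nu_of_unit (S : USetting E) {x : E} (hx : S.nu x = 0) : ¬ 1 ≤ S.nu x := by
  rw [hx]
  norm_cast

lemma sqeps_ne_zero (S : USetting E) : S.sqeps ≠ 0 := S.ne_zero_of_unit S.nu_sqeps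

/-! ### The group `K` -/

lemma mem_Gset_iff (S : USetting E) (g : Mat E) : g ∈ Gset S ↔
    S.sig (g 0 0) * g 1 0 + S.sig (g 1 0) * g 0 0 = 0 ∧
    S.sig (g 0 0) * g 1 1 + S.sig (g 1 0) * g 0 1 = 1 ∧
    S.sig (g 0 1) * g 1 0 + S.sig (g 1 1) * g 0 0 = 1 ∧
    S.sig (g 0 1) * g 1 1 + S.sig (g 1 1) * g 0 1 = 0 := by
  simp only [Gset, Set.mem_ofPred_eq, ← Matrix.ext_iff, Fin.forall_fin_two, w0, Matrix.mul_apply,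
    Fin.sum_univ_two, Matrix.transpose_apply, Matrix.map_apply]
  simp [add_comm, and_assoc]

/-- The inverse of an element of the unitary group, as a matrix of conjugates. -/
def conjInv (S : USetting E) (g : Mat E) : Mat E := w0 E * (g.map ⇑S.sig)ᵀ * w0 E

lemma conjInv_eq (S : USetting E) (g : Mat E) : S.conjInv g =
    !![S.sig (g 1 1), S.sig (g 0 1); S.sig (g 1 0), S.sig (g 0 0)] := by
  ext i j
  fin_cases i <;> fin_cases j <;>
    simp [conjInv, w0, Matrix.mul_apply, Matrix.vecMul, dotProduct, Fin.sum_univ_two]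

lemma w0_mul_w0 : w0 E * w0 E = 1 := by
  ext i j
  fin_cases i <;> fin_cases j <;> simp [w0, Matrix.mul_apply, Fin.sum_univ_two]

lemma conjInv_mul (S : USetting E) {g : Mat E} (hg : g ∈ Gset S) : S.conjInv g * g = 1 := by
  have h : (g.map ⇑S.sig)ᵀ * w0 E * g = w0 E := hg
  rw [conjInv, Matrix.mul_assoc, Matrix.mul_assoc, ← Matrix.mul_assoc _ (w0 E) g, h, w0_mul_w0]

lemma mul_conjInv (S : USetting E) {g : Mat E} (hg : g ∈ Gset S) : g * S.conjInv g = 1 :=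
  mul_eq_one_comm.1 (S.conjInv_mul hg)

lemma mul_mem_Kset (S : USetting E) {g h : Mat E} (hg : g ∈ Kset S) (hh : h ∈ Kset S) :
    g * h ∈ Kset S := by
  obtain ⟨hg1, hg2, hg3⟩ := hg
  obtain ⟨hh1, hh2, hh3⟩ := hh
  refine ⟨?_, fun i j => ?_, ?_⟩
  · have h1 : (g.map ⇑S.sig)ᵀ * w0 E * g = w0 E := hg1
    have h2 : (h.map ⇑S.sig)ᵀ * w0 E * h = w0 E := hh1
    change ((g * h).map ⇑S.sig)ᵀ * w0 E * (g * h) = w0 E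
    rw [Matrix.map_mul, Matrix.transpose_mul]
    calc _ = (h.map ⇑S.sig)ᵀ * ((g.map ⇑S.sig)ᵀ * w0 E * g) * h := by
          simp only [Matrix.mul_assoc]
      _ = _ := by rw [h1, h2]
  · rw [Matrix.mul_apply, Fin.sum_univ_two]
    exact S.le_nu_add (S.le_nu_mul_left (hg2 _ _) (hh2 _ _))
      (S.le_nu_mul_left (hg2 _ _) (hh2 _ _))
  · rw [Matrix.det_mul, S.nu_mul_of_unit hg3, hh3]

lemma conjInv_mem_Kset (S : USetting E) {g : Mat E} (hg : g ∈ Kset S) :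
    S.conjInv g ∈ Kset S := by
  obtain ⟨hg1, hg2, hg3⟩ := hg
  have hm := S.mul_conjInv hg1
  rw [conjInv_eq] at hm ⊢
  refine ⟨(S.mem_Gset_iff _).2 ?_, fun i j => ?_, ?_⟩
  · simp only [← Matrix.ext_iff, Fin.forall_fin_two, Matrix.mul_apply, Fin.sum_univ_two] at hm
    simp at hm
    simp only [Matrix.of_apply, Matrix.cons_val', Matrix.cons_val_zero, Matrix.cons_val_one,
      Matrix.cons_val_fin_one, S.sig_invol]
    grind
  · fin_cases i <;> fin_cases j <;> simp [S.nu_sig, hg2]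
  · rw [← hg3, ← S.nu_sig, Matrix.det_fin_two, Matrix.det_fin_two]
    simp [S.sig_invol, mul_comm]

lemma w0_mem_Kset (S : USetting E) : w0 E ∈ Kset S := by
  refine ⟨(S.mem_Gset_iff _).2 (by simp [w0]), fun i j => ?_, ?_⟩
  · fin_cases i <;> fin_cases j <;> simp [w0, S.nu_zero, S.nu_one]
  · rw [Matrix.det_fin_two]
    simp [w0, S.nu_neg, S.nu_one]

/-- The lower unipotent matrix with lower left entry `y`. -/
def lowUni (y : E) : Mat E := !![1, 0; y, 1]

lemma lowUni_mem_Kset (S : USetting E) {y : E} (hy : S.sig y = -y) (h0 : 0 ≤ S.nu y) :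
    lowUni y ∈ Kset S := by
  refine ⟨(S.mem_Gset_iff _).2 (by simp [lowUni, hy]), fun i j => ?_, ?_⟩
  · fin_cases i <;> fin_cases j <;> simp [lowUni, S.nu_zero, S.nu_one, h0]
  · rw [Matrix.det_fin_two]
    simp [lowUni, S.nu_one]

lemma lowUni_mul (x y : E) : lowUni x * lowUni y = lowUni (x + y) := by
  ext i j
  fin_cases i <;> fin_cases j <;> simp [lowUni, Matrix.mul_apply, Fin.sum_univ_two]

lemma lowUni_zero : lowUni (0 : E) = 1 := by
  ext i j
  fin_cases i <;> fin_cases j <;> simp [lowUni]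

lemma one_mem_Kset (S : USetting E) : (1 : Mat E) ∈ Kset S := by
  rw [← lowUni_zero]
  exact S.lowUni_mem_Kset (by simp) (by simp [S.nu_zero])

lemma lowUni_conj_mem_Kfil (S : USetting E) {k : Mat E} (hk : k ∈ Kset S) {y : E}
    (hy : S.sig y = -y) (h1 : 1 ≤ S.nu y) :
    S.conjInv k * (lowUni y * k) ∈ Kfil S 1 := by
  have hk' := S.conjInv_mem_Kset hk
  refine ⟨S.mul_mem_Kset hk' (S.mul_mem_Kset
    (S.lowUni_mem_Kset hy (zero_le_one.trans h1)) hk), fun i j => ?_⟩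
  have h : S.conjInv k * (lowUni y * k) - 1 = S.conjInv k * ((lowUni y - 1) * k) := by
    rw [Matrix.sub_mul, Matrix.mul_sub, Matrix.one_mul, S.conjInv_mul hk.1]
  rw [h]
  have e : ((S.conjInv k) * ((lowUni y - 1) * k)) i j = S.conjInv k i 1 * (y * k 0 j) := by
    fin_cases i <;> fin_cases j <;> simp [lowUni, Matrix.mul_apply, Fin.sum_univ_two]
  rw [e]
  exact S.le_nu_mul_left (hk'.2.1 _ _) (S.le_nu_mul_right (by exact_mod_cast h1) (hk.2.1 _ _))

lemma sig_div_eq_neg (S : USetting E) {k : Mat E} (hk : k ∈ Kset S) (hd : S.nu (k 1 1) = 0) :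
    S.sig (k 1 0 / k 1 1) = -(k 1 0 / k 1 1) := by
  have h := congrFun (congrFun (S.mul_conjInv hk.1) 1) 0
  rw [conjInv_eq, Matrix.mul_apply, Fin.sum_univ_two] at h
  simp at h
  have h1 := S.ne_zero_of_unit hd
  have h2 : S.sig (k 1 1) ≠ 0 := S.ne_zero_of_unit (by rw [S.nu_sig, hd])
  rw [map_div₀]
  field_simp
  linear_combination h

/-! ### Bottom rows modulo the maximal ideal -/

/-- The determinant of the bottom rows of two matrices. -/
def cross (k l : Mat E) : E := k 1 0 * l 1 1 - l 1 0 * k 1 1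

/-- The bottom rows define the same point of the projective line over the residue field. -/
def SameRow (S : USetting E) (k l : Mat E) : Prop := 1 ≤ S.nu (cross k l)

lemma SameRow.symm {S : USetting E} {k l : Mat E} (h : S.SameRow k l) : S.SameRow l k := by
  rw [SameRow, show cross l k = -cross k l by simp only [cross]; ring, S.nu_neg]
  exact h

lemma sameRow_refl (S : USetting E) (k : Mat E) : S.SameRow k k := by
  rw [SameRow, cross, sub_self]
  exact S.one_le_nu_zero

lemma unit_of_mem_Kset (S : USetting E) {k : Mat E} (hk : k ∈ Kset S) :
    S.nu (k 1 0) = 0 ∨ S.nu (k 1 1) = 0 := by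
  by_contra! h
  have h0 := S.one_le_nu_of_ne_zero (hk.2.1 _ _) h.1
  have h1 := S.one_le_nu_of_ne_zero (hk.2.1 _ _) h.2
  refine S.not_one_le_nu_of_unit hk.2.2 ?_
  rw [Matrix.det_fin_two]
  exact S.le_nu_sub (S.le_nu_mul_left (hk.2.1 _ _) h1) (S.le_nu_mul_left (hk.2.1 _ _) h0)

lemma SameRow.trans {S : USetting E} {k l m : Mat E} (hk : k ∈ Kset S) (hl : l ∈ Kset S)
    (hm : m ∈ Kset S) (hkl : S.SameRow k l) (hlm : S.SameRow l m) : S.SameRow k m := by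
  have key (j : Fin 2) : l 1 j * cross k m = k 1 j * cross l m + m 1 j * cross k l := by
    fin_cases j <;> simp only [cross] <;> simp <;> ring
  obtain ⟨j, hj⟩ : ∃ j, S.nu (l 1 j) = 0 :=
    (S.unit_of_mem_Kset hl).elim (fun h => ⟨0, h⟩) (fun h => ⟨1, h⟩)
  rw [SameRow, ← S.nu_mul_of_unit hj, key]
  exact S.le_nu_add (S.le_nu_mul_left (hk.2.1 _ _) hlm) (S.le_nu_mul_left (hm.2.1 _ _) hkl)

lemma sameRow_mul_right_iff (S : USetting E) {g : Mat E} (hg : g ∈ Kset S) (k l : Mat E) :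
    S.SameRow (k * g) (l * g) ↔ S.SameRow k l := by
  have h : cross (k * g) (l * g) = g.det * cross k l := by
    simp only [cross, Matrix.mul_apply, Fin.sum_univ_two, Matrix.det_fin_two]
    ring
  rw [SameRow, h, S.nu_mul_of_unit hg.2.2, SameRow]

lemma sameRow_Bcal_mul (S : USetting E) {b : Mat E} (hb : b ∈ Bcal S) (k : Mat E) :
    S.SameRow (b * k) k := by
  have h : cross (b * k) k = 0 := by
    simp only [cross, Matrix.mul_apply, Fin.sum_univ_two, hb.2]
    ring
  rw [SameRow, h]
  exact S.one_le_nu_zero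

lemma sameRow_mul_Kfil (S : USetting E) {k g : Mat E} (hk : k ∈ Kset S) (hg : g ∈ Kfil S 1) :
    S.SameRow (k * g) k := by
  have h : cross (k * g) k = k 1 1 * (k 1 0 * (g - 1) 0 0) + k 1 1 * (k 1 1 * (g - 1) 1 0) -
      k 1 0 * (k 1 0 * (g - 1) 0 1) - k 1 0 * (k 1 1 * (g - 1) 1 1) := by
    simp only [cross, Matrix.mul_apply, Fin.sum_univ_two]
    simp
    ring
  have hk' := hk.2.1
  have hp (i j a b) : 1 ≤ S.nu (k 1 a * (k 1 b * (g - 1) i j)) :=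
    S.le_nu_mul_left (hk' _ _) (S.le_nu_mul_left (hk' _ _) (by exact_mod_cast hg.2 i j))
  rw [SameRow, h]
  exact S.le_nu_sub (S.le_nu_sub (S.le_nu_add (hp _ _ _ _) (hp _ _ _ _)) (hp _ _ _ _))
    (hp _ _ _ _)

/-- `V_1^{K_1}` for the trivial character. -/
abbrev trivSp (S : USetting E) : Submodule ℂ (Mat E → ℂ) := Vsp S (fun _ : E => (1 : ℂ)) 1

lemma eq_of_sameRow (S : USetting E) {f : Mat E → ℂ} (hf : f ∈ S.trivSp) {k l : Mat E}
    (hk : k ∈ Kset S) (hl : l ∈ Kset S) (h : S.SameRow k l) : f k = f l := by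
  obtain ⟨-, hB, hK⟩ := hf
  have hl' := S.conjInv_mem_Kset hl
  set m : Mat E := k * S.conjInv l with hm
  have hmK : m ∈ Kset S := S.mul_mem_Kset hk hl'
  have hml : m * l = k := by rw [hm, Matrix.mul_assoc, S.conjInv_mul hl.1, Matrix.mul_one]
  have hm0 : 1 ≤ S.nu (m 1 0) := by
    have h1 : S.SameRow (m * l) (1 * l) := by rwa [hml, Matrix.one_mul]
    rw [S.sameRow_mul_right_iff hl, SameRow, cross] at h1
    simpa using h1
  have hm1 : S.nu (m 1 1) = 0 := (S.unit_of_mem_Kset hmK).resolve_left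
    fun h0 => S.not_one_le_nu_of_unit h0 hm0
  have hy := S.sig_div_eq_neg hmK hm1
  set y : E := m 1 0 / m 1 1 with hyd
  have hy1 : 1 ≤ S.nu y := by rwa [hyd, S.nu_div_of_unit hm1]
  have hyK : lowUni y ∈ Kset S := S.lowUni_mem_Kset hy (zero_le_one.trans hy1)
  have hb : m * lowUni (-y) ∈ Bcal S := by
    refine ⟨S.mul_mem_Kset hmK (S.lowUni_mem_Kset (by simp [hy])
      (by rw [S.nu_neg]; exact zero_le_one.trans hy1)), ?_⟩
    have hne := S.ne_zero_of_unit hm1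
    simp only [Matrix.mul_apply, Fin.sum_univ_two, lowUni, hyd]
    simp
    field_simp
    ring
  have hk1 : k = m * lowUni (-y) * (lowUni y * l) := by
    rw [Matrix.mul_assoc, ← Matrix.mul_assoc (lowUni (-y)), lowUni_mul, neg_add_cancel,
      lowUni_zero, Matrix.one_mul, hml]
  have hk2 : lowUni y * l = l * (S.conjInv l * (lowUni y * l)) := by
    rw [← Matrix.mul_assoc l, S.mul_conjInv hl.1, Matrix.one_mul]
  rw [hk1, hB _ hb _ (S.mul_mem_Kset hyK hl), one_mul, hk2,
    hK l hl _ (S.lowUni_conj_mem_Kfil hl hy hy1)]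

lemma mem_trivSp_iff (S : USetting E) (f : Mat E → ℂ) : f ∈ S.trivSp ↔
    (∀ x, x ∉ Kset S → f x = 0) ∧
    ∀ k ∈ Kset S, ∀ l ∈ Kset S, S.SameRow k l → f k = f l := by
  refine ⟨fun hf => ⟨hf.1, fun k hk l hl => S.eq_of_sameRow hf hk hl⟩, fun ⟨h0, h⟩ => ⟨h0, ?_, ?_⟩⟩
  · intro b hb k hk
    rw [one_mul]
    exact h _ (S.mul_mem_Kset hb.1 hk) _ hk (S.sameRow_Bcal_mul hb k)
  · intro k hk g hg
    exact h _ (S.mul_mem_Kset hk hg.1) _ hk (S.sameRow_mul_Kfil hk hg)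

lemma mul_mem_Kset_iff (S : USetting E) {g : Mat E} (hg : g ∈ Kset S) (k : Mat E) :
    k * g ∈ Kset S ↔ k ∈ Kset S := by
  refine ⟨fun h => ?_, fun h => S.mul_mem_Kset h hg⟩
  have h1 := S.mul_mem_Kset h (S.conjInv_mem_Kset hg)
  rwa [Matrix.mul_assoc, S.mul_conjInv hg.1, Matrix.mul_one] at h1

lemma kInvariant_trivSp (S : USetting E) : KInvariant S S.trivSp := by
  intro g hg f hf
  rw [mem_trivSp_iff] at hf ⊢
  refine ⟨fun x hx => hf.1 _ (by rwa [S.mul_mem_Kset_iff hg]), fun k hk l hl h => ?_⟩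
  exact hf.2 _ (S.mul_mem_Kset hk hg) _ (S.mul_mem_Kset hl hg)
    ((S.sameRow_mul_right_iff hg _ _).2 h)

lemma kInvariant_constSub (S : USetting E) : KInvariant S (ConstSub S) := by
  rintro g hg f ⟨h0, c, hc⟩
  exact ⟨fun x hx => h0 _ (by rwa [S.mul_mem_Kset_iff hg]),
    c, fun k hk => hc _ (S.mul_mem_Kset hk hg)⟩

lemma constSub_le (S : USetting E) : ConstSub S ≤ S.trivSp := by
  rintro f ⟨h0, c, hc⟩
  rw [mem_trivSp_iff]
  exact ⟨h0, fun k hk l hl _ => by rw [hc k hk, hc l hl]⟩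

open Classical in
/-- The indicator function of `K`. -/
def oneK (S : USetting E) : Mat E → ℂ := fun k => if k ∈ Kset S then 1 else 0

lemma oneK_apply (S : USetting E) {k : Mat E} (hk : k ∈ Kset S) : S.oneK k = 1 := if_pos hk

lemma oneK_mem (S : USetting E) : S.oneK ∈ ConstSub S :=
  ⟨fun _ hx => if_neg hx, 1, fun _ hk => if_pos hk⟩

lemma constSub_eq_span (S : USetting E) : ConstSub S = ℂ ∙ S.oneK := by
  refine le_antisymm ?_ ((Submodule.span_singleton_le_iff_mem _ _).2 S.oneK_mem)
  rintro f ⟨h0, c, hc⟩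
  refine Submodule.mem_span_singleton.2 ⟨c, funext fun k => ?_⟩
  by_cases hk : k ∈ Kset S
  · simp [S.oneK_apply hk, hc k hk]
  · simp [oneK, hk, h0 k hk]

lemma oneK_ne_zero (S : USetting E) : S.oneK ≠ 0 := fun h => by
  have h1 := S.oneK_apply S.one_mem_Kset
  simp [h] at h1

lemma finrank_constSub (S : USetting E) : Module.finrank ℂ (ConstSub S) = 1 := by
  rw [constSub_eq_span]
  exact finrank_span_singleton S.oneK_ne_zero

/-! ### Representatives of the projective line -/

/-- `R` is a set of representatives of the residue field of the fixed field of `sig`. -/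
def IsResidueSystem (S : USetting E) (R : Finset E) : Prop :=
  (∀ x ∈ R, S.sig x = x ∧ 0 ≤ S.nu x) ∧
    ∀ y : E, S.sig y = y → 0 ≤ S.nu y → ∃! x, x ∈ R ∧ 1 ≤ S.nu (y - x)

/-- Representatives in `K` of the points of the projective line over the residue field. -/
def rep (S : USetting E) {R : Finset E} : Option R → Mat E
  | none => w0 E
  | some t => lowUni (t * S.sqeps)

section Representatives

variable {S : USetting E} {R : Finset E}

lemma rep_mem (hR : S.IsResidueSystem R) (x : Option R) : S.rep x ∈ Kset S := by
  cases x with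
  | none => exact S.w0_mem_Kset
  | some t =>
    refine S.lowUni_mem_Kset ?_ (S.le_nu_mul_left (hR.1 t t.2).2 S.nu_sqeps.ge)
    rw [map_mul, (hR.1 t t.2).1, S.sig_sqeps, mul_neg]

lemma exists_sameRow_rep (hR : S.IsResidueSystem R) {k : Mat E} (hk : k ∈ Kset S) :
    ∃ x : Option R, S.SameRow k (S.rep x) := by
  by_cases hd : S.nu (k 1 1) = 0
  · have hs := S.sig_div_eq_neg hk hd
    obtain ⟨t, ⟨ht, h1⟩, -⟩ := hR.2 (k 1 0 / k 1 1 / S.sqeps)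
      (by rw [map_div₀, hs, S.sig_sqeps, neg_div_neg_eq])
      (by rw [S.nu_div_of_unit S.nu_sqeps, S.nu_div_of_unit hd]; exact hk.2.1 _ _)
    refine ⟨some ⟨t, ht⟩, ?_⟩
    have e : cross k (S.rep (some (⟨t, ht⟩ : R))) =
        k 1 1 * (S.sqeps * (k 1 0 / k 1 1 / S.sqeps - t)) := by
      have := S.ne_zero_of_unit hd
      have := S.sqeps_ne_zero
      simp only [cross, rep, lowUni]
      simp
      field_simp
    rwa [SameRow, e, S.nu_mul_of_unit hd, S.nu_mul_of_unit S.nu_sqeps]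
  · refine ⟨none, ?_⟩
    have e : cross k (S.rep (none : Option R)) = - k 1 1 := by simp [cross, rep, w0]
    rw [SameRow, e, S.nu_neg]
    exact S.one_le_nu_of_ne_zero (hk.2.1 _ _) hd

lemma eq_of_sameRow_rep (hR : S.IsResidueSystem R) {x y : Option R}
    (h : S.SameRow (S.rep x) (S.rep y)) : x = y := by
  cases x with
  | none =>
    cases y with
    | none => rfl
    | some t =>
      exact absurd h (S.not_one_le_nu_of_unit (by simp [cross, rep, w0, lowUni, S.nu_one]))
  | some s =>
    cases y with
    | none =>
      exact absurd h (S.not_one_le_nu_of_unit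
        (by simp [cross, rep, w0, lowUni, S.nu_one, S.nu_neg]))
    | some t =>
      have e : cross (S.rep (some s)) (S.rep (some t)) = S.sqeps * ((s : E) - t) := by
        simp [cross, rep, lowUni]
        ring
      rw [SameRow, e, S.nu_mul_of_unit S.nu_sqeps] at h
      have := (hR.2 s (hR.1 s s.2).1 (hR.1 s s.2).2).unique
        ⟨s.2, by rw [sub_self]; exact S.one_le_nu_zero⟩ ⟨t.2, h⟩
      rw [Subtype.ext this]

lemma ext_rep (hR : S.IsResidueSystem R) {f g : Mat E → ℂ} (hf : f ∈ S.trivSp)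
    (hg : g ∈ S.trivSp) (h : ∀ x : Option R, f (S.rep x) = g (S.rep x)) : f = g := by
  funext k
  by_cases hk : k ∈ Kset S
  · obtain ⟨x, hx⟩ := exists_sameRow_rep hR hk
    rw [S.eq_of_sameRow hf hk (rep_mem hR x) hx, S.eq_of_sameRow hg hk (rep_mem hR x) hx, h]
  · rw [hf.1 k hk, hg.1 k hk]

open Classical in
lemma exists_mem_trivSp (hR : S.IsResidueSystem R) (φ : Option R → ℂ) :
    ∃ f ∈ S.trivSp, ∀ x, f (S.rep x) = φ x := by
  refine ⟨fun k => if k ∈ Kset S then ∑ x, if S.SameRow k (S.rep x) then φ x else 0 else 0,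
    (S.mem_trivSp_iff _).2 ⟨fun x hx => if_neg hx, fun k hk l hl h => ?_⟩, fun x => ?_⟩
  · simp only [if_pos hk, if_pos hl]
    refine Finset.sum_congr rfl fun x _ => ?_
    have : S.SameRow k (S.rep x) ↔ S.SameRow l (S.rep x) :=
      ⟨fun h' => h.symm.trans hl hk (rep_mem hR x) h', fun h' => h.trans hk hl (rep_mem hR x) h'⟩
    simp only [this]
  · have : ∀ y : Option R, S.SameRow (S.rep x) (S.rep y) ↔ x = y := fun y =>
      ⟨eq_of_sameRow_rep hR, fun h => h ▸ S.sameRow_refl _⟩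
    simp [if_pos (rep_mem hR x), this]

/-- Evaluation at the representatives. -/
def evalRep (S : USetting E) (R : Finset E) : S.trivSp →ₗ[ℂ] (Option R → ℂ) where
  toFun f x := (f : Mat E → ℂ) (S.rep x)
  map_add' _ _ := rfl
  map_smul' _ _ := rfl

lemma evalRep_bijective (hR : S.IsResidueSystem R) : Function.Bijective (S.evalRep R) := by
  refine ⟨fun f g h => Subtype.ext (ext_rep hR f.2 g.2 fun x => congrFun h x), fun φ => ?_⟩
  obtain ⟨f, hf, h⟩ := exists_mem_trivSp hR φ
  exact ⟨⟨f, hf⟩, funext h⟩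

lemma finrank_trivSp (hR : S.IsResidueSystem R) : Module.finrank ℂ S.trivSp = R.card + 1 := by
  rw [(LinearEquiv.ofBijective _ (evalRep_bijective hR)).finrank_eq]
  simp

/-! ### Invariant subspaces -/

/-- The sum of the values at the representatives. -/
def total (S : USetting E) (R : Finset E) : (Mat E → ℂ) →ₗ[ℂ] ℂ where
  toFun f := ∑ x : Option R, f (S.rep x)
  map_add' f g := by simp [Finset.sum_add_distrib]
  map_smul' c f := by simp only [Pi.smul_apply, ← Finset.smul_sum, RingHom.id_apply]

lemma total_apply (S : USetting E) (R : Finset E) (f : Mat E → ℂ) :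
    S.total R f = ∑ x : Option R, f (S.rep x) := rfl

lemma total_oneK (hR : S.IsResidueSystem R) : S.total R S.oneK = R.card + 1 := by
  simp [total_apply, S.oneK_apply (rep_mem hR _)]

lemma total_rho (hR : S.IsResidueSystem R) {f : Mat E → ℂ} (hf : f ∈ S.trivSp) {g : Mat E}
    (hg : g ∈ Kset S) : S.total R (rho g f) = S.total R f := by
  choose p hp using fun x : Option R =>
    exists_sameRow_rep hR (S.mul_mem_Kset (rep_mem hR x) hg)
  have hinj : Function.Injective p := fun x y hxy => by
    have h := hp x
    rw [hxy] at h
    have h' := h.trans (S.mul_mem_Kset (rep_mem hR x) hg) (rep_mem hR _)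
      (S.mul_mem_Kset (rep_mem hR y) hg) (hp y).symm
    exact eq_of_sameRow_rep hR ((S.sameRow_mul_right_iff hg _ _).1 h')
  refine Eq.trans ?_ ((Finite.injective_iff_bijective.1 hinj).sum_comp fun x => f (S.rep x))
  exact Finset.sum_congr rfl fun x _ =>
    S.eq_of_sameRow hf (S.mul_mem_Kset (rep_mem hR x) hg) (rep_mem hR _) (hp x)

/-- Averaging over the lower unipotent matrices. -/
lemma exists_average_mem (hR : S.IsResidueSystem R) {U : Submodule ℂ (Mat E → ℂ)}
    (hU : U ≤ S.trivSp) (hinv : KInvariant S U) {f : Mat E → ℂ} (hf : f ∈ U) :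
    ∃ F ∈ U, F (w0 E) = R.card * f (w0 E) ∧
      ∀ k ∈ Kset S, ¬ S.SameRow k (w0 E) → F k = S.total R f - f (w0 E) := by
  have hF : ∑ t : R, rho (S.rep (some t)) f ∈ U :=
    Submodule.sum_mem _ fun t _ => hinv _ (rep_mem hR _) f hf
  refine ⟨_, hF, ?_, fun k hk hne => ?_⟩
  · rw [Finset.sum_apply]
    have h (t : R) : rho (S.rep (some t)) f (w0 E) = f (w0 E) := by
      refine S.eq_of_sameRow (hU hf) (S.mul_mem_Kset S.w0_mem_Kset (rep_mem hR _))
        S.w0_mem_Kset ?_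
      rw [SameRow, show cross (w0 E * S.rep (some t)) (w0 E) = 0 by
        simp [cross, w0, rep, lowUni]]
      exact S.one_le_nu_zero
    simp [h]
  · obtain ⟨x, hx⟩ := exists_sameRow_rep hR hk
    cases x with
    | none => exact absurd hx hne
    | some s =>
      rw [S.eq_of_sameRow (hU hF) hk (rep_mem hR _) hx, Finset.sum_apply,
        ← total_rho hR (hU hf) (rep_mem hR (some s)), total_apply, Fintype.sum_option]
      have h : rho (S.rep (some s)) f (S.rep (none : Option R)) = f (w0 E) := by
        refine S.eq_of_sameRow (hU hf) (S.mul_mem_Kset S.w0_mem_Kset (rep_mem hR _))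
          S.w0_mem_Kset ?_
        rw [SameRow, show cross (S.rep (none : Option R) * S.rep (some s)) (w0 E) = 0 by
          simp [cross, w0, rep, lowUni]]
        exact S.one_le_nu_zero
      rw [h, add_sub_cancel_left]
      refine Finset.sum_congr rfl fun t _ => ?_
      change f (lowUni _ * lowUni _) = f (lowUni _ * lowUni _)
      rw [lowUni_mul, lowUni_mul, add_comm]

/-- An invariant subspace containing `f` contains a combination of any `h` and the constants. -/
lemma combination_mem (hR : S.IsResidueSystem R) {U : Submodule ℂ (Mat E → ℂ)}
    (hU : U ≤ S.trivSp) (hinv : KInvariant S U) {f h : Mat E → ℂ} (hf : f ∈ U)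
    (hh : h ∈ S.trivSp) :
    ((R.card + 1) * f (w0 E) - S.total R f) • h +
      ((S.total R f - f (w0 E)) * S.total R h) • S.oneK ∈ U := by
  classical
  obtain ⟨F, hF, hF0, hF1⟩ := exists_average_mem hR hU hinv hf
  have hg (x : Option R) : S.conjInv (S.rep x) * w0 E ∈ Kset S :=
    S.mul_mem_Kset (S.conjInv_mem_Kset (rep_mem hR x)) S.w0_mem_Kset
  have hsum : ∑ x : Option R, h (S.rep x) • rho (S.conjInv (S.rep x) * w0 E) F ∈ U :=
    Submodule.sum_mem _ fun x _ => Submodule.smul_mem _ _ (hinv _ (hg x) F hF)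
  convert hsum using 1
  refine ext_rep hR (add_mem (Submodule.smul_mem _ _ hh)
    (Submodule.smul_mem _ _ (S.constSub_le S.oneK_mem))) (hU hsum) fun y => ?_
  have hw (x : Option R) : S.rep x * (S.conjInv (S.rep x) * w0 E) = w0 E := by
    rw [← Matrix.mul_assoc, S.mul_conjInv (rep_mem hR x).1, Matrix.one_mul]
  have hval (x : Option R) : rho (S.conjInv (S.rep x) * w0 E) F (S.rep y) =
      (S.total R f - f (w0 E)) +
        if x = y then (R.card + 1) * f (w0 E) - S.total R f else 0 := by
    change F (S.rep y * (S.conjInv (S.rep x) * w0 E)) = _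
    split_ifs with hxy
    · rw [hxy, hw, hF0]
      ring
    · rw [hF1 _ (S.mul_mem_Kset (rep_mem hR y) (hg x)), add_zero]
      intro hs
      nth_rewrite 2 [← hw x] at hs
      exact hxy (eq_of_sameRow_rep hR ((S.sameRow_mul_right_iff (hg x) _ _).1 hs)).symm
  simp only [Finset.sum_apply, Pi.smul_apply, smul_eq_mul, Pi.add_apply, hval, mul_add,
    Finset.sum_add_distrib, ← Finset.sum_mul, ← total_apply, mul_ite, mul_zero,
    Finset.sum_ite_eq', Finset.mem_univ, if_true, S.oneK_apply (rep_mem hR y)]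
  ring

/-- The functions whose values at the representatives sum to zero. -/
def sumZero (S : USetting E) (R : Finset E) : Submodule ℂ (Mat E → ℂ) :=
  S.trivSp ⊓ LinearMap.ker (S.total R)

lemma kInvariant_sumZero (hR : S.IsResidueSystem R) : KInvariant S (S.sumZero R) :=
  fun g hg f hf => ⟨S.kInvariant_trivSp g hg f hf.1, by
    rw [SetLike.mem_coe, LinearMap.mem_ker, total_rho hR hf.1 hg]; exact hf.2⟩

lemma constSub_inf_sumZero (hR : S.IsResidueSystem R) : ConstSub S ⊓ S.sumZero R = ⊥ := by
  rw [eq_bot_iff, constSub_eq_span]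
  rintro f ⟨h1, -, h2⟩
  obtain ⟨c, rfl⟩ := Submodule.mem_span_singleton.1 h1
  rw [SetLike.mem_coe, LinearMap.mem_ker, map_smul, total_oneK hR, smul_eq_mul, mul_eq_zero] at h2
  simp [h2.resolve_right (Nat.cast_add_one_ne_zero _)]

lemma constSub_sup_sumZero (hR : S.IsResidueSystem R) :
    ConstSub S ⊔ S.sumZero R = S.trivSp := by
  refine le_antisymm (sup_le S.constSub_le inf_le_left) fun f hf => ?_
  have h1 : (S.total R f / (R.card + 1)) • S.oneK ∈ ConstSub S :=
    Submodule.smul_mem _ _ S.oneK_mem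
  refine Submodule.mem_sup.2 ⟨_, h1, _, ⟨sub_mem hf (S.constSub_le h1), ?_⟩, add_sub_cancel _ f⟩
  rw [SetLike.mem_coe, LinearMap.mem_ker, map_sub, map_smul, total_oneK hR, smul_eq_mul,
    div_mul_cancel₀ _ (Nat.cast_add_one_ne_zero _), sub_self]

lemma card_ne_zero (hR : S.IsResidueSystem R) : R.card ≠ 0 := by
  obtain ⟨x, ⟨hx, -⟩, -⟩ := hR.2 0 (map_zero _) (by simp [S.nu_zero])
  exact Finset.card_ne_zero_of_mem hx

/-- `sumZero` is the only invariant complement of the constants. -/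
lemma eq_sumZero (hR : S.IsResidueSystem R) {W : Submodule ℂ (Mat E → ℂ)} (hW : W ≤ S.trivSp)
    (hinv : KInvariant S W) (hinf : ConstSub S ⊓ W = ⊥) (hsup : ConstSub S ⊔ W = S.trivSp) :
    W = S.sumZero R := by
  have hle : W ≤ S.sumZero R := fun f hf => by
    refine ⟨hW hf, ?_⟩
    have h1 := combination_mem hR hW hinv hf (S.constSub_le S.oneK_mem)
    rw [← add_smul, total_oneK hR] at h1
    have h2 : _ ∈ ConstSub S ⊓ W := ⟨Submodule.smul_mem _ _ S.oneK_mem, h1⟩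
    rw [hinf, Submodule.mem_bot, smul_eq_zero] at h2
    have h3 : (R.card : ℂ) * S.total R f = 0 := by
      linear_combination h2.resolve_right S.oneK_ne_zero
    exact (mul_eq_zero.1 h3).resolve_left (Nat.cast_ne_zero.2 (card_ne_zero hR))
  refine le_antisymm hle fun f hf => ?_
  obtain ⟨c, hc, w, hw, rfl⟩ := Submodule.mem_sup.1 (hsup.ge hf.1)
  have h : c ∈ ConstSub S ⊓ S.sumZero R := by
    refine ⟨hc, ?_⟩
    have := sub_mem hf (hle hw)
    rwa [add_sub_cancel_right] at this
  rw [constSub_inf_sumZero hR, Submodule.mem_bot] at h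
  rwa [h, zero_add]

lemma eq_bot_or_eq_sumZero (hR : S.IsResidueSystem R) {U : Submodule ℂ (Mat E → ℂ)}
    (hU : U ≤ S.sumZero R) (hinv : KInvariant S U) : U = ⊥ ∨ U = S.sumZero R := by
  refine or_iff_not_imp_left.2 fun hne => le_antisymm hU fun h hh => ?_
  obtain ⟨f, hf, hf0⟩ := Submodule.exists_mem_ne_zero_of_ne_bot hne
  obtain ⟨k, hk⟩ := Function.ne_iff.1 hf0
  have hkK : k ∈ Kset S := by
    by_contra h0
    exact hk ((hU hf).1.1 k h0)
  have hF := hinv _ (S.mul_mem_Kset S.w0_mem_Kset hkK) f hf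
  have hF0 : rho (w0 E * k) f (w0 E) ≠ 0 := by
    change f (w0 E * (w0 E * k)) ≠ 0
    rwa [← Matrix.mul_assoc, w0_mul_w0, Matrix.one_mul]
  have h1 := combination_mem hR (hU.trans inf_le_left) hinv hF hh.1
  rw [show S.total R (rho (w0 E * k) f) = 0 from (hU hF).2,
    show S.total R h = 0 from hh.2, mul_zero, zero_smul, add_zero, sub_zero] at h1
  exact (Submodule.smul_mem_iff _ (mul_ne_zero (Nat.cast_add_one_ne_zero _) hF0)).1 h1

lemma finrank_sumZero (hR : S.IsResidueSystem R) :
    Module.finrank ℂ (S.sumZero R) = R.card := by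
  have hV := finrank_trivSp hR
  have : FiniteDimensional ℂ S.trivSp := Module.finite_of_finrank_pos (by omega)
  have : FiniteDimensional ℂ (S.sumZero R) := Submodule.finiteDimensional_of_le inf_le_left
  have : FiniteDimensional ℂ (ConstSub S) := Submodule.finiteDimensional_of_le S.constSub_le
  have h := Submodule.finrank_sup_add_finrank_inf_eq (ConstSub S) (S.sumZero R)
  rw [constSub_sup_sumZero hR, constSub_inf_sumZero hR, finrank_bot, hV,
    S.finrank_constSub] at h
  omega

lemma isIrredRep_sumZero (hR : S.IsResidueSystem R) : IsIrredRep S (S.sumZero R) := by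
  refine ⟨fun h => ?_, kInvariant_sumZero hR, fun U hU hinv => eq_bot_or_eq_sumZero hR hU hinv⟩
  have h1 := finrank_sumZero hR
  rw [h, finrank_bot] at h1
  exact card_ne_zero hR h1.symm

end Representatives

end USetting

/-- for the trivial character, `V_1^{K_1}` has dimension `q+1`, the constants
form a one-dimensional `K`-invariant subspace, that subspace has a unique `K`-invariant
complement, and the complement is irreducible of dimension `q`. -/
theorem stmt8 (S : USetting E) :
    Module.finrank ℂ ↥(Vsp S (fun _ : E => (1 : ℂ)) 1) = S.q + 1 ∧
    (ConstSub S ≤ Vsp S (fun _ : E => (1 : ℂ)) 1 ∧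
      Module.finrank ℂ ↥(ConstSub S) = 1 ∧ KInvariant S (ConstSub S)) ∧
    (∃! W : Submodule ℂ (Mat E → ℂ), W ≤ Vsp S (fun _ : E => (1 : ℂ)) 1 ∧
        KInvariant S W ∧ ConstSub S ⊓ W = ⊥ ∧
        ConstSub S ⊔ W = Vsp S (fun _ : E => (1 : ℂ)) 1) ∧
    (∀ W : Submodule ℂ (Mat E → ℂ),
      (W ≤ Vsp S (fun _ : E => (1 : ℂ)) 1 ∧ KInvariant S W ∧ ConstSub S ⊓ W = ⊥ ∧
        ConstSub S ⊔ W = Vsp S (fun _ : E => (1 : ℂ)) 1) →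
      IsIrredRep S W ∧ Module.finrank ℂ ↥W = S.q) := by
  obtain ⟨R, hq, hR⟩ := S.res_card
  replace hR : S.IsResidueSystem R := hR
  rw [← hq]
  refine ⟨USetting.finrank_trivSp hR,
    ⟨S.constSub_le, S.finrank_constSub, S.kInvariant_constSub⟩,
    ⟨S.sumZero R, ⟨inf_le_left, USetting.kInvariant_sumZero hR, USetting.constSub_inf_sumZero hR,
      USetting.constSub_sup_sumZero hR⟩, fun W ⟨h1, h2, h3, h4⟩ =>
      USetting.eq_sumZero hR h1 h2 h3 h4⟩, fun W ⟨h1, h2, h3, h4⟩ => ?_⟩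
  rw [USetting.eq_sumZero hR h1 h2 h3 h4]
  exact ⟨USetting.isIrredRep_sumZero hR, USetting.finrank_sumZero hR⟩
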